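/- With ≤_lex the lexicographic order on {0,±1}^∞ induced by −1 < 0 < 1: (i) L̃_2 = π_2(M^abs_{≤_lex}) ∩ [0, 1/2] and L̃_2 ≠ π_2(M^abs_{≤_lex}); (ii) L̃_3 = π_3(M^abs_{≤_lex}); (iii) for every integer q ≥ 4, π_q(M^abs_{≤_lex}) = L̃_q ∩ [0, 1/(q−1)] and π_q(M^abs_{≤_lex}) ≠ L̃_q. -/

import Mathlib

open scoped Classical

noncomputable section

/-- The ultrametric on infinite words: `d(a,b) = 2^{-min{n ≥ 1 : a_n ≠ b_n}}`
(words are indexed from 0 here, so position `i` corresponds to `n = i+1`). -/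
noncomputable def wdist {A : Type*} [DecidableEq A] (a b : ℕ → A) : ℝ :=
  if h : ∃ n, a n ≠ b n then (2 : ℝ)⁻¹ ^ (Nat.find h + 1) else 0

/-- The tail `a_{k+1} a_{k+2} ⋯` of an infinite word. -/
def shiftn {A : Type*} (a : ℕ → A) (k : ℕ) : ℕ → A := fun n => a (n + k)

/-- The set of tails of an infinite word (including the word itself). -/
def tails {A : Type*} (a : ℕ → A) : Set (ℕ → A) := {b | ∃ k, b = shiftn a k}

/-- A cylinder order: a total order such that `a ≤ b ≤ c` implies `d(a,b) ≤ d(a,c)`. -/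
def IsCylOrder {A : Type*} [DecidableEq A] (le : (ℕ → A) → (ℕ → A) → Prop) : Prop :=
  (∀ a b, le a b ∨ le b a) ∧
  (∀ a b, le a b → le b a → a = b) ∧
  (∀ a b c, le a b → le b c → le a c) ∧
  (∀ a b c, le a b → le b c → wdist a b ≤ wdist a c)

/-- Strict comparison associated to an order relation. -/
def wlt {A : Type*} (le : (ℕ → A) → (ℕ → A) → Prop) (a b : ℕ → A) : Prop :=
  le a b ∧ a ≠ b

/-- `m` is the least upper bound of the set `s` with respect to `le`. -/
def IsSupOf {A : Type*} (le : (ℕ → A) → (ℕ → A) → Prop) (s : Set (ℕ → A))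
    (m : ℕ → A) : Prop :=
  (∀ x ∈ s, le x m) ∧ ∀ b, (∀ x ∈ s, le x b) → le m b

/-- The set `M_≤ = {s_≤(a) : a ∈ A^∞}` of sup-words. -/
def supWords {A : Type*} (le : (ℕ → A) → (ℕ → A) → Prop) : Set (ℕ → A) :=
  {m | ∃ a, IsSupOf le (tails a) m}

/-- `x` is an accumulation point of `M` in the metric `wdist`. -/
def IsAccPt' {A : Type*} [DecidableEq A] (M : Set (ℕ → A)) (x : ℕ → A) : Prop :=
  ∀ ε : ℝ, 0 < ε → ∃ y ∈ M, y ≠ x ∧ wdist x y < ε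

/-- `x` is the smallest (w.r.t. `le`) accumulation point of `M`. -/
def IsSmallestAcc {A : Type*} [DecidableEq A] (le : (ℕ → A) → (ℕ → A) → Prop)
    (M : Set (ℕ → A)) (x : ℕ → A) : Prop :=
  IsAccPt' M x ∧ ∀ y, IsAccPt' M y → le x y

/-- Membership in the cylinder given by the finite word `w`. -/
def inCyl {A : Type*} (w : List A) (a : ℕ → A) : Prop :=
  ∀ i : Fin w.length, a i.val = w.get i

/-- `[u] < [v]` for cylinders: every element of `[u]` is strictly below every element of `[v]`. -/
def cylLt {A : Type*} (le : (ℕ → A) → (ℕ → A) → Prop) (u v : List A) : Prop :=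
  ∀ a b, inCyl u a → inCyl v b → wlt le a b

/-- Infinite binary words. -/
abbrev W2 := ℕ → Bool

/-- The word `0^∞`. -/
def w0 : W2 := fun _ => false

/-- The word `1^∞`. -/
def w1 : W2 := fun _ => true

/-- The word `10^∞`. -/
def w10inf : W2 := fun n => decide (n = 0)

/-- The periodic word `w^∞` for a finite word `w`. -/
def perW (w : List Bool) : W2 := fun n => w.getD (n % w.length) false

/-- A substitution on `{0,1}`, given by the images of the two letters. -/
abbrev Sub2 := Bool → List Bool

/-- Action of a substitution on finite words. -/
def listApply (f : Sub2) (l : List Bool) : List Bool := (l.map f).flatten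

/-- Action of a (nonerasing) substitution on infinite words. -/
def subApply (f : Sub2) (a : W2) : W2 :=
  fun n => (listApply f (List.ofFn (fun i : Fin (n + 1) => a i.val))).getD n false

/-- The substitution `τ_{j,k} : 0 ↦ 10^j, 1 ↦ 10^k`. -/
def tauS (j k : ℕ) : Sub2 := fun b => true :: List.replicate (if b then k else j) false

/-- Membership in the set `S = {τ_{j,k} : 0 ≤ j < k}`. -/
def memS (f : Sub2) : Prop := ∃ j k : ℕ, j < k ∧ f = tauS j k

/-- Apply a finite composition `σ_1 ∘ ⋯ ∘ σ_n` (given as a list) to an infinite word. -/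
def applyList (L : List Sub2) (a : W2) : W2 := L.foldr subApply a

/-- Apply a finite composition `σ_1 ∘ ⋯ ∘ σ_n` (given as a list) to a finite word. -/
def listApplyL (L : List Sub2) (l : List Bool) : List Bool := L.foldr listApply l

/-- `σ_{[1,n]} = σ_1 ∘ ⋯ ∘ σ_n` applied to an infinite word, for `σ ∈ S^∞`
(indexed from 0 in Lean). -/
def compUpTo (σ : ℕ → Sub2) (n : ℕ) (a : W2) : W2 :=
  applyList (List.ofFn (fun i : Fin n => σ i.val)) a

/-- `m` is the limit word `lim_{n → ∞} σ_{[1,n]}(a)`. -/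
def IsLimitWord (σ : ℕ → Sub2) (a m : W2) : Prop :=
  ∀ ε : ℝ, 0 < ε → ∃ N : ℕ, ∀ n ≥ N, wdist (compUpTo σ n a) m < ε

/-- The symmetric alphabet `{0, ±1}`. -/
inductive T3 where
  | neg : T3
  | zer : T3
  | pos : T3
deriving DecidableEq

/-- The integer value of a letter in `{0, ±1}`. -/
def T3.toInt : T3 → ℤ
  | .neg => -1
  | .zer => 0
  | .pos => 1

/-- Negation of a letter. -/
def T3.negT : T3 → T3
  | .neg => .pos
  | .zer => .zer
  | .pos => .neg

/-- The natural order `-1 < 0 < 1` on letters. -/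
def t3lt (x y : T3) : Prop := x.toInt < y.toInt

/-- Infinite words over `{0, ±1}`. -/
abbrev W3 := ℕ → T3

/-- Letterwise negation of a word. -/
def negW (a : W3) : W3 := fun n => (a n).negT

/-- Strict lexicographic order on `{0,±1}^∞` induced by `-1 < 0 < 1`. -/
def lex3lt (a b : W3) : Prop := ∃ i : ℕ, (∀ m < i, a m = b m) ∧ t3lt (a i) (b i)

/-- Lexicographic order on `{0,±1}^∞` induced by `-1 < 0 < 1`. -/
def lex3le (a b : W3) : Prop := a = b ∨ lex3lt a b

/-- The word `0^∞` over `{0,±1}`. -/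
def zeroW3 : W3 := fun _ => T3.zer

/-- The word `1^∞` over `{0,±1}`. -/
def oneW3 : W3 := fun _ => T3.pos

/-- `abs(a) = a` if `a ≥_lex 0^∞` and `-a` otherwise. -/
noncomputable def absW (a : W3) : W3 := if lex3le zeroW3 a then a else negW a

/-- The set `{abs(a_n a_{n+1} ⋯) : n ≥ 1}`. -/
def absTails (a : W3) : Set W3 := {b | ∃ k, b = absW (shiftn a k)}

/-- The set `M^abs_≤ = {s^abs_≤(a) : a ∈ {0,±1}^∞}`, where `s^abs_≤(a)` is the least upper
bound of `{abs(a_n a_{n+1} ⋯) : n ≥ 1}` with respect to `≤`. -/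
def MAbs (le : W3 → W3 → Prop) : Set W3 := {m | ∃ a, IsSupOf le (absTails a) m}

/-- A cylinder order on `{0,±1}^∞` is consistent if for each finite word `w` either
`[w(-1)] < [w0] < [w1]` or `[w(-1)] > [w0] > [w1]`. -/
def Consistent (le : W3 → W3 → Prop) : Prop :=
  ∀ w : List T3,
    (cylLt le (w ++ [T3.neg]) (w ++ [T3.zer]) ∧ cylLt le (w ++ [T3.zer]) (w ++ [T3.pos])) ∨
    (cylLt le (w ++ [T3.pos]) (w ++ [T3.zer]) ∧ cylLt le (w ++ [T3.zer]) (w ++ [T3.neg]))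

/-- Image of a letter under a `ρ`-map: letter `0 ↦ e` and letter `1 ↦ e0`, where the
sign `e` is `1` if the parity bit is `true` and `-1` otherwise. -/
def rhoImg (e : Bool) (b : Bool) : List T3 :=
  (if e then T3.pos else T3.neg) :: (if b then [T3.zer] else [])

/-- The `ρ`-map on finite words determined by a parity function `par` (where `par w`
is `true` when the relevant count of `w` is even). -/
def rhoL (par : List Bool → Bool) (l : List Bool) : List T3 :=
  (List.ofFn (fun i : Fin l.length => rhoImg (par (l.take i.val)) (l.get i))).flatten

/-- The extension of a `ρ`-map to infinite words (as the limit of its values on prefixes). -/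
def rhoW (par : List Bool → Bool) (a : W2) : W3 :=
  fun n => (rhoL par (List.ofFn (fun i : Fin (n + 1) => a i.val))).getD n T3.zer

/-- Parity for `ρ_0`: evenness of the number of 0's. -/
def par0 : List Bool → Bool := fun w => decide (Even (w.count false))

/-- Parity for `ρ_1`: evenness of the number of 1's. -/
def par1 : List Bool → Bool := fun w => decide (Even (w.count true))

/-- Parity for `ρ_2`: evenness of the length. -/
def par2 : List Bool → Bool := fun w => decide (Even w.length)

/-- The substitution `τ_{0,1} : 0 ↦ 1, 1 ↦ 10` viewed with values in `{0,±1}`. -/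
def tau01T : Bool → List T3 := fun b => if b then [T3.pos, T3.zer] else [T3.pos]

/-- Action on infinite words of a substitution from `{0,1}` to `{0,±1}`-words. -/
def subApply3 (f : Bool → List T3) (a : W2) : W3 :=
  fun n => ((List.ofFn (fun i : Fin (n + 1) => a i.val)).map f).flatten.getD n T3.zer

/-- The set of maps `{ρ_0, ρ_1, ρ_2, τ_{0,1}}` from `{0,1}^∞` to `{0,±1}^∞`. -/
def sigmaSet : Set (W2 → W3) := {rhoW par0, rhoW par1, rhoW par2, subApply3 tau01T}

/-- `π_β(a) = Σ_{n ≥ 1} a_n β^{-n}` for a word over `{0,±1}`. -/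
noncomputable def piBeta3 (β : ℝ) (a : W3) : ℝ :=
  ∑' n : ℕ, ((a n).toInt : ℝ) / β ^ (n + 1)

/-- Distance from a real number to the nearest integer. -/
noncomputable def distNearInt (y : ℝ) : ℝ := |y - round y|

/-- The multiplicative Lagrange spectrum `L̃_q = {limsup_{n→∞} ‖x q^n‖ : x ∈ ℝ}`. -/
noncomputable def Ltilde (q : ℝ) : Set ℝ :=
  {r | ∃ x : ℝ, Filter.limsup (fun n : ℕ => distNearInt (x * q ^ n)) Filter.atTop = r}

/-! ### The compact space of words -/

instance : TopologicalSpace T3 := ⊥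

instance : DiscreteTopology T3 := ⟨rfl⟩

instance : Fintype T3 := ⟨{T3.neg, T3.zer, T3.pos}, fun x => by cases x <;> simp⟩

theorem T3.toInt_injective : Function.Injective T3.toInt := by
  intro x y h
  cases x <;> cases y <;> simp_all [T3.toInt]

theorem T3.toInt_negT (x : T3) : x.negT.toInt = -x.toInt := by
  cases x <;> rfl

theorem T3.negT_negT (x : T3) : x.negT.negT = x := by
  cases x <;> rfl

theorem T3.neg_one_le_toInt (x : T3) : -1 ≤ x.toInt := by
  cases x <;> decide

theorem T3.toInt_le_one (x : T3) : x.toInt ≤ 1 := by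
  cases x <;> decide

theorem T3.abs_toInt_le_one (x : T3) : |(x.toInt : ℝ)| ≤ 1 := by
  cases x <;> simp [T3.toInt]

theorem negW_negW (a : W3) : negW (negW a) = a :=
  funext fun n => (a n).negT_negT

theorem shiftn_shiftn {A : Type*} (a : ℕ → A) (j k : ℕ) :
    shiftn (shiftn a j) k = shiftn a (j + k) := by
  funext n
  simp only [shiftn]
  congr 1
  omega

theorem shiftn_zero {A : Type*} (a : ℕ → A) : shiftn a 0 = a := rfl

theorem negW_shiftn (a : W3) (k : ℕ) : negW (shiftn a k) = shiftn (negW a) k := rfl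

theorem continuous_shiftn (k : ℕ) : Continuous fun a : W3 => shiftn a k :=
  continuous_pi fun n => continuous_apply (n + k)

theorem continuous_negW : Continuous negW :=
  continuous_pi fun n => (continuous_of_discreteTopology (f := T3.negT)).comp (continuous_apply n)

theorem cylinder_mem_nhds (b : W3) (N : ℕ) : {x : W3 | ∀ i < N, x i = b i} ∈ nhds b := by
  have h : ∀ᶠ x in nhds b, ∀ i ∈ Set.Iio N, x i = b i := by
    rw [Filter.eventually_all_finite (Set.finite_Iio N)]
    intro i _
    exact (continuous_apply i).continuousAt.eventually_mem
      (show {b i} ∈ nhds (b i) by simp)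
  exact h

theorem exists_cylinder_subset {b : W3} {U : Set W3} (hU : U ∈ nhds b) :
    ∃ N, ∀ x : W3, (∀ i < N, x i = b i) → x ∈ U := by
  by_contra! h
  choose u hu hU' using h
  have ht : Filter.Tendsto u Filter.atTop (nhds b) := by
    rw [tendsto_pi_nhds]
    intro i
    refine tendsto_const_nhds.congr' ?_
    filter_upwards [Filter.eventually_gt_atTop i] with N hN
    exact (hu N i hN).symm
  obtain ⟨N, hN⟩ := (ht.eventually_mem hU).exists
  exact hU' N hN

theorem IsClosed.mem_of_forall_prefix {F : Set W3} (hF : IsClosed F) {b : W3}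
    (h : ∀ N, ∃ u ∈ F, ∀ i < N, u i = b i) : b ∈ F := by
  rw [← hF.closure_eq, mem_closure_iff_nhds]
  intro U hU
  obtain ⟨N, hN⟩ := exists_cylinder_subset hU
  obtain ⟨u, huF, hu⟩ := h N
  exact ⟨u, hN u hu, huF⟩

/-- Every prefix of `b` occurs infinitely often in `a`. -/
def IsTailLimit (a b : W3) : Prop :=
  ∀ N, ∃ᶠ j in Filter.atTop, ∀ i < N, a (i + j) = b i

theorem exists_isTailLimit_of_frequently {a : W3} {F : Set W3} (hF : IsClosed F)
    (h : ∃ᶠ j in Filter.atTop, shiftn a j ∈ F) : ∃ b ∈ F, IsTailLimit a b := by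
  obtain ⟨b, hb, hc⟩ := hF.isCompact.exists_mapClusterPt_of_frequently h
  exact ⟨b, hb, fun N => hc.frequently (cylinder_mem_nhds b N)⟩

theorem IsTailLimit.frequently {a b : W3} (h : IsTailLimit a b) {U : Set W3}
    (hU : U ∈ nhds b) : ∃ᶠ j in Filter.atTop, shiftn a j ∈ U := by
  obtain ⟨N, hN⟩ := exists_cylinder_subset hU
  exact (h N).mono fun j hj => hN _ hj

theorem IsTailLimit.tail {a b : W3} (h : IsTailLimit a b) (k : ℕ) :
    IsTailLimit a (shiftn b k) := by
  intro N
  rw [Filter.frequently_atTop]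
  intro n
  obtain ⟨j, hj, hj'⟩ := Filter.frequently_atTop.1 (h (N + k)) n
  refine ⟨j + k, by omega, fun i hi => ?_⟩
  rw [← add_assoc, add_right_comm]
  exact hj' (i + k) (by omega)

theorem isClosed_isTailLimit (a : W3) : IsClosed {b | IsTailLimit a b} := by
  refine isClosed_of_closure_subset fun b hb N => ?_
  obtain ⟨u, hu, hu'⟩ := mem_closure_iff_nhds.1 hb _ (cylinder_mem_nhds b N)
  exact (hu' N).mono fun j hj i hi => (hj i hi).trans (hu i hi)

/-! ### The map `piBeta3` -/

theorem piBeta3_term_le {q : ℝ} (hq : 1 < q) (a : W3) (n : ℕ) :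
    ‖((a n).toInt : ℝ) / q ^ (n + 1)‖ ≤ q⁻¹ * q⁻¹ ^ n := by
  have h0 : 0 < q := by linarith
  rw [norm_div, Real.norm_eq_abs, Real.norm_eq_abs, abs_of_pos (pow_pos h0 _),
    ← pow_succ', inv_pow, ← one_div]
  gcongr
  exact (a n).abs_toInt_le_one

theorem summable_geometric_bound {q : ℝ} (hq : 1 < q) :
    Summable fun n : ℕ => q⁻¹ * q⁻¹ ^ n :=
  (summable_geometric_of_lt_one (by positivity) (inv_lt_one_of_one_lt₀ hq)).mul_left _

theorem summable_piBeta3 {q : ℝ} (hq : 1 < q) (a : W3) :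
    Summable fun n : ℕ => ((a n).toInt : ℝ) / q ^ (n + 1) :=
  Summable.of_norm_bounded (summable_geometric_bound hq) (piBeta3_term_le hq a)

theorem continuous_piBeta3 {q : ℝ} (hq : 1 < q) : Continuous (piBeta3 q) := by
  refine continuous_tsum (fun n => ?_) (summable_geometric_bound hq)
    fun n a => piBeta3_term_le hq a n
  exact ((continuous_of_discreteTopology (f := fun x : T3 => (x.toInt : ℝ))).comp
    (continuous_apply n)).div_const _

theorem piBeta3_eq {q : ℝ} (hq : 1 < q) (a : W3) :
    q * piBeta3 q a = (a 0).toInt + piBeta3 q (shiftn a 1) := by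
  have h0 : q ≠ 0 := by linarith
  unfold piBeta3
  rw [(summable_piBeta3 hq a).tsum_eq_zero_add, mul_add, ← tsum_mul_left]
  congr 1
  · field_simp
    ring
  · refine tsum_congr fun n => ?_
    simp only [shiftn]
    field_simp
    ring

theorem piBeta3_shiftn {q : ℝ} (hq : 1 < q) (a : W3) (k : ℕ) :
    q * piBeta3 q (shiftn a k) = (a k).toInt + piBeta3 q (shiftn a (k + 1)) := by
  rw [piBeta3_eq hq, shiftn_shiftn]
  simp [shiftn]

theorem piBeta3_negW (q : ℝ) (a : W3) : piBeta3 q (negW a) = -piBeta3 q a := by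
  unfold piBeta3
  rw [← tsum_neg]
  refine tsum_congr fun n => ?_
  simp [negW, T3.toInt_negT, neg_div]

theorem piBeta3_zeroW3 (q : ℝ) : piBeta3 q zeroW3 = 0 := by
  simp [piBeta3, zeroW3, T3.toInt]

theorem abs_piBeta3_le {q : ℝ} (hq : 1 < q) (a : W3) : |piBeta3 q a| ≤ 1 / (q - 1) := by
  have h := tsum_of_norm_bounded (summable_geometric_bound hq).hasSum (piBeta3_term_le hq a)
  rw [tsum_mul_left, tsum_geometric_of_lt_one (by positivity) (inv_lt_one_of_one_lt₀ hq)] at h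
  refine (Real.norm_eq_abs _ ▸ h).trans_eq ?_
  have h1 : q - 1 ≠ 0 := by linarith
  have h0 : q ≠ 0 := by linarith
  field_simp

theorem piBeta3_oneW3 {q : ℝ} (hq : 1 < q) : piBeta3 q oneW3 = 1 / (q - 1) := by
  have h := piBeta3_eq hq oneW3
  have h' : shiftn oneW3 1 = oneW3 := rfl
  rw [h', show (oneW3 0).toInt = 1 from rfl] at h
  have h1 : q - 1 ≠ 0 := by linarith
  push_cast at h
  field_simp
  linarith

theorem piBeta3_eq_of_bounded {q : ℝ} (hq : 1 < q) {a : W3} {e : ℕ → ℝ} {B : ℝ}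
    (hB : ∀ n, |e n| ≤ B) (h : ∀ n, q * e n = (a n).toInt + e (n + 1)) (n : ℕ) :
    piBeta3 q (shiftn a n) = e n := by
  have h0 : 0 < q := by linarith
  have key : ∀ k, |piBeta3 q (shiftn a n) - e n| ≤ (1 / (q - 1) + B) * q⁻¹ ^ k := by
    intro k
    have hk : q ^ k * (piBeta3 q (shiftn a n) - e n) =
        piBeta3 q (shiftn a (n + k)) - e (n + k) := by
      induction k with
      | zero => simp
      | succ k ih =>
        have h1 := piBeta3_shiftn hq a (n + k)
        have h2 := h (n + k)
        rw [pow_succ', mul_assoc, ih, mul_sub, h1, h2, add_assoc]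
        ring
    have h3 : q ^ k * |piBeta3 q (shiftn a n) - e n| ≤ 1 / (q - 1) + B := by
      have h4 := congrArg abs hk
      rw [abs_mul, abs_of_pos (pow_pos h0 k)] at h4
      rw [h4]
      exact (abs_sub _ _).trans (add_le_add (abs_piBeta3_le hq _) (hB _))
    rw [inv_pow, ← div_eq_mul_inv, le_div_iff₀ (pow_pos h0 k), mul_comm]
    exact h3
  have ht : Filter.Tendsto (fun k : ℕ => (1 / (q - 1) + B) * q⁻¹ ^ k) Filter.atTop (nhds 0) := by
    simpa using (tendsto_pow_atTop_nhds_zero_of_lt_one (by positivity)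
      (inv_lt_one_of_one_lt₀ hq)).const_mul (1 / (q - 1) + B)
  have := ge_of_tendsto' ht key
  exact sub_eq_zero.1 (abs_nonpos_iff.1 this)

theorem pow_mul_piBeta3_sub {q : ℝ} (hq : 1 < q) {a b : W3} {n : ℕ}
    (h : ∀ i < n, a i = b i) :
    q ^ n * (piBeta3 q b - piBeta3 q a) =
      piBeta3 q (shiftn b n) - piBeta3 q (shiftn a n) := by
  induction n with
  | zero => simp [shiftn_zero]
  | succ n ih =>
    have h1 := piBeta3_shiftn hq a n
    have h2 := piBeta3_shiftn hq b n
    rw [h n n.lt_succ_self] at h1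
    rw [pow_succ', mul_assoc, ih fun i hi => h i (hi.trans n.lt_succ_self), mul_sub, h1, h2]
    ring

theorem exists_lt_piBeta3_sub {q c : ℝ} (hq : 1 < q) {a b : W3} (h : lex3lt a b)
    (ha : ∀ k, |piBeta3 q (shiftn a k)| ≤ c) (hb : ∀ k, |piBeta3 q (shiftn b k)| ≤ c) :
    ∃ n : ℕ, 1 - 2 * c ≤ q ^ n * (piBeta3 q b - piBeta3 q a) := by
  obtain ⟨n, hn, hlt⟩ := h
  refine ⟨n + 1, ?_⟩
  have hlt' : ((a n).toInt : ℝ) + 1 ≤ (b n).toInt := by exact_mod_cast hlt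
  have h1 := piBeta3_shiftn hq a n
  have h2 := piBeta3_shiftn hq b n
  rw [pow_succ', mul_assoc, pow_mul_piBeta3_sub hq hn, mul_sub, h1, h2]
  have := (abs_le.1 (ha (n + 1))).2
  have := (abs_le.1 (hb (n + 1))).1
  linarith

theorem piBeta3_le_of_lex3le {q : ℝ} (hq : 1 < q) {a b : W3} (h : lex3le a b)
    (ha : ∀ k, |piBeta3 q (shiftn a k)| ≤ 1 / 2) (hb : ∀ k, |piBeta3 q (shiftn b k)| ≤ 1 / 2) :
    piBeta3 q a ≤ piBeta3 q b := by
  rcases h with rfl | h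
  · rfl
  · obtain ⟨n, hn⟩ := exists_lt_piBeta3_sub hq h ha hb
    have : 0 ≤ piBeta3 q b - piBeta3 q a :=
      nonneg_of_mul_nonneg_right (by linarith) (pow_pos (by linarith : 0 < q) n)
    linarith

/-! ### The lexicographic order through `piBeta3 4` -/

theorem one_lt_four_real : (1 : ℝ) < 4 := by norm_num

theorem piBeta3_four_lt_of_lex3lt {a b : W3} (h : lex3lt a b) : piBeta3 4 a < piBeta3 4 b := by
  have hc : ∀ (x : W3) (k : ℕ), |piBeta3 4 (shiftn x k)| ≤ 1 / 3 := fun x k =>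
    (abs_piBeta3_le one_lt_four_real _).trans_eq (by norm_num)
  obtain ⟨n, hn⟩ := exists_lt_piBeta3_sub one_lt_four_real h (hc a) (hc b)
  have : 0 < piBeta3 4 b - piBeta3 4 a :=
    pos_of_mul_pos_right (lt_of_lt_of_le (by norm_num) hn) (by positivity)
  linarith

theorem lex3lt_or_lex3lt_of_ne {a b : W3} (h : a ≠ b) : lex3lt a b ∨ lex3lt b a := by
  have hex : ∃ n, a n ≠ b n := Function.ne_iff.1 h
  have hmin : ∀ i < Nat.find hex, a i = b i := fun i hi => not_not.1 (Nat.find_min hex hi)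
  rcases lt_or_gt_of_ne (T3.toInt_injective.ne (Nat.find_spec hex)) with hlt | hlt
  · exact Or.inl ⟨_, hmin, hlt⟩
  · exact Or.inr ⟨_, fun i hi => (hmin i hi).symm, hlt⟩

theorem lex3le_iff {a b : W3} : lex3le a b ↔ piBeta3 4 a ≤ piBeta3 4 b := by
  constructor
  · rintro (rfl | h)
    · rfl
    · exact (piBeta3_four_lt_of_lex3lt h).le
  · intro h
    by_cases hab : a = b
    · exact Or.inl hab
    · rcases lex3lt_or_lex3lt_of_ne hab with h' | h'
      · exact Or.inr h'
      · exact absurd (piBeta3_four_lt_of_lex3lt h') h.not_gt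

theorem piBeta3_four_injective : Function.Injective (piBeta3 4) := by
  intro a b h
  by_contra hab
  rcases lex3lt_or_lex3lt_of_ne hab with h' | h'
  · exact (piBeta3_four_lt_of_lex3lt h').ne h
  · exact (piBeta3_four_lt_of_lex3lt h').ne' h

theorem toInt_le_of_lex3le {a b : W3} (h : lex3le a b) {n : ℕ} (hn : ∀ i < n, a i = b i) :
    (a n).toInt ≤ (b n).toInt := by
  rcases h with rfl | ⟨i, hi, hlt⟩
  · rfl
  · rcases lt_trichotomy i n with h' | rfl | h'
    · rw [t3lt, hn i h'] at hlt
      exact absurd hlt (lt_irrefl _)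
    · exact hlt.le
    · rw [hi n h']

theorem piBeta3_four_absW (a : W3) : piBeta3 4 (absW a) = |piBeta3 4 a| := by
  unfold absW
  split_ifs with h
  · rw [lex3le_iff, piBeta3_zeroW3] at h
    rw [abs_of_nonneg h]
  · rw [lex3le_iff, piBeta3_zeroW3, not_le] at h
    rw [abs_of_neg h, piBeta3_negW]

theorem isCompact_exists_lex_max {C : Set W3} (hC : IsClosed C) (hne : C.Nonempty) :
    ∃ m ∈ C, ∀ b ∈ C, piBeta3 4 b ≤ piBeta3 4 m :=
  hC.isCompact.exists_isMaxOn hne (continuous_piBeta3 one_lt_four_real).continuousOn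

/-- All `abs`-tails of `m` are lexicographically at most `m`. -/
def IsAbsMax (m : W3) : Prop := ∀ k, |piBeta3 4 (shiftn m k)| ≤ piBeta3 4 m

theorem isAbsMax_of_mem {C : Set W3} {m : W3} (hm : m ∈ C)
    (hmax : ∀ b ∈ C, piBeta3 4 b ≤ piBeta3 4 m) (hshift : ∀ b ∈ C, ∀ k, shiftn b k ∈ C)
    (hneg : ∀ b ∈ C, negW b ∈ C) : IsAbsMax m := by
  intro k
  have h1 := hmax _ (hshift m hm k)
  have h2 := hmax _ (hneg _ (hshift m hm k))
  rw [piBeta3_negW] at h2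
  exact abs_le'.2 ⟨h1, h2⟩

theorem mem_MAbs_iff {m : W3} : m ∈ MAbs lex3le ↔ IsAbsMax m := by
  constructor
  · rintro ⟨a, hub, hlub⟩
    let G : Set W3 := {b | ∃ k, b = shiftn a k ∨ b = negW (shiftn a k)}
    obtain ⟨m', hm', hmax⟩ := isCompact_exists_lex_max (isClosed_closure (s := G))
      ⟨a, subset_closure ⟨0, Or.inl rfl⟩⟩
    have hle : lex3le m m' := by
      refine hlub _ ?_
      rintro x ⟨k, rfl⟩
      refine lex3le_iff.2 (hmax _ (subset_closure ⟨k, ?_⟩))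
      unfold absW
      split_ifs
      exacts [Or.inl rfl, Or.inr rfl]
    have hsub : closure G ⊆ {b | piBeta3 4 b ≤ piBeta3 4 m} := by
      refine closure_minimal ?_
        (isClosed_le (continuous_piBeta3 one_lt_four_real) continuous_const)
      rintro b ⟨k, hb⟩
      have h := lex3le_iff.1 (hub _ ⟨k, rfl⟩)
      rw [piBeta3_four_absW] at h
      rcases hb with rfl | rfl
      · exact (le_abs_self _).trans h
      · rw [Set.mem_ofPred_eq, piBeta3_negW]
        exact (neg_le_abs _).trans h
    obtain rfl : m = m' := piBeta3_four_injective (le_antisymm (lex3le_iff.1 hle) (hsub hm'))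
    refine isAbsMax_of_mem hm' hmax (fun b hb k => ?_) (fun b hb => ?_)
    · refine map_mem_closure (f := fun a : W3 => shiftn a k) (continuous_shiftn k) hb ?_
      rintro x ⟨j, rfl | rfl⟩
      · exact ⟨j + k, Or.inl (shiftn_shiftn a j k)⟩
      · exact ⟨j + k, Or.inr (congrArg negW (shiftn_shiftn a j k))⟩
    · refine map_mem_closure continuous_negW hb ?_
      rintro x ⟨j, rfl | rfl⟩
      · exact ⟨j, Or.inr rfl⟩
      · exact ⟨j, Or.inl (negW_negW _)⟩
  · intro h
    refine ⟨m, ?_, fun b hb => ?_⟩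
    · rintro x ⟨k, rfl⟩
      rw [lex3le_iff, piBeta3_four_absW]
      exact h k
    · have := lex3le_iff.1 (hb _ ⟨0, rfl⟩)
      rw [piBeta3_four_absW, shiftn_zero] at this
      exact lex3le_iff.2 ((le_abs_self _).trans this)

theorem IsAbsMax.shiftn_le {m : W3} (h : IsAbsMax m) (k : ℕ) : lex3le (shiftn m k) m :=
  lex3le_iff.2 ((le_abs_self _).trans (h k))

theorem IsAbsMax.negW_shiftn_le {m : W3} (h : IsAbsMax m) (k : ℕ) :
    lex3le (negW (shiftn m k)) m :=
  lex3le_iff.2 (piBeta3_negW 4 _ ▸ (neg_le_abs _).trans (h k))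

theorem isAbsMax_oneW3 : IsAbsMax oneW3 := fun k => by
  rw [piBeta3_oneW3 one_lt_four_real]
  exact abs_piBeta3_le one_lt_four_real _

/-! ### Distance to the nearest integer and upper limits -/

theorem distNearInt_le_half (y : ℝ) : distNearInt y ≤ 1 / 2 := abs_sub_round y

theorem distNearInt_nonneg (y : ℝ) : 0 ≤ distNearInt y := abs_nonneg _

theorem distNearInt_le_abs (y : ℝ) : distNearInt y ≤ |y| := by
  simpa [distNearInt] using round_le y 0

theorem distNearInt_le_add (y z : ℝ) : distNearInt y ≤ distNearInt z + |z - y| := by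
  have h := (round_le y (round z)).trans (abs_sub_le y z (round z))
  rw [abs_sub_comm y z] at h
  exact h.trans_eq (add_comm _ _)

theorem distNearInt_of_abs_le {y : ℝ} (h : |y| ≤ 1 / 2) : distNearInt y = |y| := by
  refine le_antisymm (distNearInt_le_abs y) ?_
  unfold distNearInt
  rcases eq_or_ne (round y) 0 with h0 | h0
  · simp [h0]
  · have h1 : (1 : ℝ) ≤ |(round y : ℝ)| := by exact_mod_cast Int.one_le_abs h0
    have h2 := abs_sub_abs_le_abs_sub (round y : ℝ) y
    rw [abs_sub_comm] at h2
    linarith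

theorem distNearInt_intCast_add (z : ℤ) (y : ℝ) : distNearInt (z + y) = distNearInt y := by
  unfold distNearInt
  rw [round_intCast_add]
  push_cast
  congr 1
  ring

theorem limsup_eq_of_frequently {u : ℕ → ℝ} {B c : ℝ} (hu : ∀ n, |u n| ≤ B)
    (hle : ∀ ε > 0, ∀ᶠ n in Filter.atTop, u n < c + ε)
    (hge : ∀ ε > 0, ∃ᶠ n in Filter.atTop, c - ε < u n) :
    Filter.limsup u Filter.atTop = c := by
  have hb : Filter.IsBoundedUnder (· ≤ ·) Filter.atTop u :=
    Filter.isBoundedUnder_of ⟨B, fun n => (abs_le.1 (hu n)).2⟩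
  have hcb : Filter.IsCoboundedUnder (· ≤ ·) Filter.atTop u :=
    Filter.IsBoundedUnder.isCoboundedUnder_le
      (Filter.isBoundedUnder_of ⟨-B, fun n => (abs_le.1 (hu n)).1⟩)
  apply le_antisymm
  · refine le_of_forall_pos_le_add fun ε hε => ?_
    exact Filter.limsup_le_of_le hcb ((hle ε hε).mono fun n hn => hn.le)
  · refine le_of_forall_sub_le fun ε hε => ?_
    exact Filter.le_limsup_of_frequently_le ((hge ε hε).mono fun n hn => hn.le) hb

theorem limsup_distNearInt_mem_Icc (u : ℕ → ℝ) :
    Filter.limsup (fun n => distNearInt (u n)) Filter.atTop ∈ Set.Icc (0 : ℝ) (1 / 2) := by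
  have hcb : Filter.IsCoboundedUnder (· ≤ ·) Filter.atTop fun n => distNearInt (u n) :=
    Filter.IsBoundedUnder.isCoboundedUnder_le
      (Filter.isBoundedUnder_of ⟨0, fun n => distNearInt_nonneg _⟩)
  constructor
  · exact Filter.le_limsup_of_frequently_le
      (Filter.Frequently.of_forall fun n => distNearInt_nonneg _)
      (Filter.isBoundedUnder_of ⟨1 / 2, fun n => distNearInt_le_half _⟩)
  · exact Filter.limsup_le_of_le hcb (Filter.Eventually.of_forall fun n => distNearInt_le_half _)

/-! ### From words to the spectrum and back -/

theorem IsAbsMax.piBeta3_nonneg {m : W3} (h : IsAbsMax m) {q : ℝ} (hq : 1 < q)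
    (hm : ∀ k, |piBeta3 q (shiftn m k)| ≤ 1 / 2) : 0 ≤ piBeta3 q m := by
  have h1 := piBeta3_le_of_lex3le hq (h.negW_shiftn_le 0)
    (fun k => by rw [shiftn_zero, ← negW_shiftn, piBeta3_negW, abs_neg]; exact hm k) hm
  rw [shiftn_zero, piBeta3_negW] at h1
  linarith

theorem abs_piBeta3_le_of_four {q : ℝ} (hq : 1 < q) {b m : W3}
    (h : |piBeta3 4 b| ≤ piBeta3 4 m) (hb : ∀ k, |piBeta3 q (shiftn b k)| ≤ 1 / 2)
    (hm : ∀ k, |piBeta3 q (shiftn m k)| ≤ 1 / 2) : |piBeta3 q b| ≤ piBeta3 q m := by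
  rw [abs_le'] at h ⊢
  refine ⟨piBeta3_le_of_lex3le hq (lex3le_iff.2 h.1) hb hm, ?_⟩
  rw [← piBeta3_negW] at h ⊢
  exact piBeta3_le_of_lex3le hq (lex3le_iff.2 h.2)
    (fun k => by rw [← negW_shiftn, piBeta3_negW, abs_neg]; exact hb k) hm

theorem eventually_abs_piBeta3_lt {q : ℝ} (hq : 1 < q) {a m : W3}
    (hm : ∀ k, |piBeta3 q (shiftn m k)| ≤ 1 / 2)
    (hle : ∀ b, IsTailLimit a b → |piBeta3 4 b| ≤ piBeta3 4 m)
    (hhalf : ∀ b, IsTailLimit a b → ∀ k, |piBeta3 q (shiftn b k)| ≤ 1 / 2)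
    {ε : ℝ} (hε : 0 < ε) :
    ∀ᶠ n in Filter.atTop, |piBeta3 q (shiftn a n)| < piBeta3 q m + ε := by
  by_contra h
  rw [Filter.not_eventually] at h
  have hF : IsClosed {y : W3 | piBeta3 q m + ε ≤ |piBeta3 q y|} :=
    isClosed_le continuous_const (continuous_piBeta3 hq).abs
  obtain ⟨b, hb, hab⟩ := exists_isTailLimit_of_frequently hF (h.mono fun n hn => not_lt.1 hn)
  have := abs_piBeta3_le_of_four hq (hle b hab) (hhalf b hab) hm
  have hb' : piBeta3 q m + ε ≤ |piBeta3 q b| := hb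
  linarith

theorem IsTailLimit.frequently_abs_sub_lt {a m : W3} (h : IsTailLimit a m) {q : ℝ} (hq : 1 < q)
    {ε : ℝ} (hε : 0 < ε) :
    ∃ᶠ n in Filter.atTop, |piBeta3 q (shiftn a n) - piBeta3 q m| < ε :=
  h.frequently ((continuous_piBeta3 hq).continuousAt (Metric.ball_mem_nhds _ hε))

/-- The lexicographically largest `abs`-tail limit of `a` realises the upper limit of the values
of its tails. -/
theorem exists_isAbsMax_limsup_eq {q : ℝ} (hq : 1 < q) {a : W3}
    (ha : ∀ k, |piBeta3 q (shiftn a k)| ≤ 1 / 2) :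
    ∃ m, IsAbsMax m ∧
      Filter.limsup (fun n => |piBeta3 q (shiftn a n)|) Filter.atTop = piBeta3 q m := by
  obtain ⟨b₀, -, hb₀⟩ := exists_isTailLimit_of_frequently (a := a) isClosed_univ
    (Filter.Frequently.of_forall fun n => Set.mem_univ _)
  let C : Set W3 := {b | IsTailLimit a b} ∪ negW ⁻¹' {b | IsTailLimit a b}
  have hC : IsClosed C := (isClosed_isTailLimit a).union
    ((isClosed_isTailLimit a).preimage continuous_negW)
  obtain ⟨m, hm, hmax⟩ := isCompact_exists_lex_max hC ⟨b₀, Or.inl hb₀⟩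
  have hneg : ∀ b ∈ C, negW b ∈ C := by
    rintro b (hb | hb)
    · exact Or.inr (by rwa [Set.mem_preimage, negW_negW])
    · exact Or.inl hb
  have hhalf : ∀ b, IsTailLimit a b → ∀ k, |piBeta3 q (shiftn b k)| ≤ 1 / 2 := by
    intro b hb k
    have hcl : IsClosed {y : W3 | |piBeta3 q y| ≤ 1 / 2} :=
      isClosed_le (continuous_piBeta3 hq).abs continuous_const
    refine hcl.mem_of_forall_prefix (b := shiftn b k) fun N => ?_
    obtain ⟨j, hj⟩ := (hb.tail k N).exists
    exact ⟨shiftn a j, ha j, hj⟩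
  have hmhalf : ∀ k, |piBeta3 q (shiftn m k)| ≤ 1 / 2 := by
    rcases hm with hm | hm
    · exact hhalf m hm
    · intro k
      rw [← abs_neg, ← piBeta3_negW]
      exact hhalf _ hm k
  have hle : ∀ b, IsTailLimit a b → |piBeta3 4 b| ≤ piBeta3 4 m := fun b hb =>
    abs_le'.2 ⟨hmax b (Or.inl hb), piBeta3_negW 4 b ▸ hmax _ (hneg b (Or.inl hb))⟩
  have hAbs : IsAbsMax m := by
    refine isAbsMax_of_mem hm hmax ?_ hneg
    rintro b (hb | hb) k
    · exact Or.inl (hb.tail k)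
    · exact Or.inr (IsTailLimit.tail hb k)
  refine ⟨m, hAbs, limsup_eq_of_frequently (B := 1 / 2) (fun n => by rw [abs_abs]; exact ha n)
    (fun ε hε => eventually_abs_piBeta3_lt hq hmhalf hle hhalf hε) fun ε hε => ?_⟩
  have hnn := hAbs.piBeta3_nonneg hq hmhalf
  obtain ⟨m', hm', hval⟩ : ∃ m', IsTailLimit a m' ∧ |piBeta3 q m'| = piBeta3 q m := by
    rcases hm with hm | hm
    · exact ⟨m, hm, abs_of_nonneg hnn⟩
    · exact ⟨negW m, hm, by rw [piBeta3_negW, abs_neg, abs_of_nonneg hnn]⟩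
  refine (hm'.frequently_abs_sub_lt hq hε).mono fun n hn => ?_
  have := abs_sub_abs_le_abs_sub (piBeta3 q m') (piBeta3 q (shiftn a n))
  rw [abs_sub_comm] at this
  linarith

theorem piBeta3_mul_pow {q : ℕ} (hq : 1 < (q : ℝ)) (a : W3) (n : ℕ) :
    ∃ z : ℤ, piBeta3 q a * (q : ℝ) ^ n = z + piBeta3 q (shiftn a n) := by
  induction n with
  | zero => exact ⟨0, by simp [shiftn_zero]⟩
  | succ n ih =>
    obtain ⟨z, hz⟩ := ih
    refine ⟨z * q + (a n).toInt, ?_⟩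
    rw [pow_succ, ← mul_assoc, hz, add_mul, mul_comm (piBeta3 _ _), piBeta3_shiftn hq]
    push_cast
    ring

/-- If `m` is a tail limit of `a`, and all tail limits of `a` are dominated by `m`,
then `piBeta3 q m` is an element of the multiplicative Lagrange spectrum. -/
theorem piBeta3_mem_Ltilde_of_isTailLimit {q : ℕ} (hq : 1 < (q : ℝ)) {a m : W3} (h : IsAbsMax m)
    (hhalf : ∀ b, (∀ k, |piBeta3 4 (shiftn b k)| ≤ piBeta3 4 m) →
      ∀ k, |piBeta3 q (shiftn b k)| ≤ 1 / 2)
    (hlim : IsTailLimit a m)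
    (hle : ∀ b, IsTailLimit a b → |piBeta3 4 b| ≤ piBeta3 4 m) :
    piBeta3 q m ∈ Ltilde q := by
  have hm := hhalf m h
  have hnn := h.piBeta3_nonneg hq hm
  have hhalf' : ∀ b, IsTailLimit a b → ∀ k, |piBeta3 q (shiftn b k)| ≤ 1 / 2 :=
    fun b hb => hhalf b fun k => hle _ (hb.tail k)
  have hval : ∀ n, distNearInt (piBeta3 q a * (q : ℝ) ^ n) =
      distNearInt (piBeta3 q (shiftn a n)) := fun n => by
    obtain ⟨z, hz⟩ := piBeta3_mul_pow hq a n
    rw [hz, distNearInt_intCast_add]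
  refine ⟨piBeta3 q a, ?_⟩
  simp only [hval]
  refine limsup_eq_of_frequently (B := 1 / 2)
    (fun n => by rw [abs_of_nonneg (distNearInt_nonneg _)]; exact distNearInt_le_half _)
    (fun ε hε => (eventually_abs_piBeta3_lt hq hm hle hhalf' hε).mono
      fun n hn => (distNearInt_le_abs _).trans_lt hn) fun ε hε => ?_
  have hval' : distNearInt (piBeta3 q m) = piBeta3 q m := by
    rw [distNearInt_of_abs_le (y := piBeta3 q m) (hm 0), abs_of_nonneg hnn]
  refine (hlim.frequently_abs_sub_lt hq hε).mono fun n hn => ?_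
  have := distNearInt_le_add (piBeta3 q m) (piBeta3 q (shiftn a n))
  linarith

theorem exists_letter {d : ℤ} (h : |d| ≤ 1) : ∃ x : T3, x.toInt = d := by
  rw [abs_le] at h
  obtain ⟨h1, h2⟩ := h
  interval_cases d
  exacts [⟨T3.neg, rfl⟩, ⟨T3.zer, rfl⟩, ⟨T3.pos, rfl⟩]

/-- If the digits of `x` in base `q` given by rounding are eventually in `{0, ±1}`, then the
corresponding element of the spectrum comes from a word. -/
theorem limsup_mem_image_of_digits {q : ℕ} (hq : 1 < (q : ℝ)) {x : ℝ}
    (h : ∀ᶠ n : ℕ in Filter.atTop,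
      |round (x * (q : ℝ) ^ (n + 1)) - q * round (x * (q : ℝ) ^ n)| ≤ 1) :
    Filter.limsup (fun n : ℕ => distNearInt (x * (q : ℝ) ^ n)) Filter.atTop ∈
      piBeta3 q '' MAbs lex3le := by
  obtain ⟨N, hN⟩ := Filter.eventually_atTop.1 h
  choose a ha using fun n => exists_letter (hN (n + N) (by omega))
  let e : ℕ → ℝ := fun n => x * (q : ℝ) ^ (n + N) - round (x * (q : ℝ) ^ (n + N))
  have he : ∀ n, |e n| ≤ 1 / 2 := fun n => abs_sub_round _
  have hrec : ∀ n, (q : ℝ) * e n = (a n).toInt + e (n + 1) := by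
    intro n
    simp only [e, ha, add_right_comm n 1 N]
    push_cast
    ring
  have hval := piBeta3_eq_of_bounded hq he hrec
  obtain ⟨m, hm, hlim⟩ := exists_isAbsMax_limsup_eq hq (a := a)
    fun k => by rw [hval]; exact he k
  refine ⟨m, mem_MAbs_iff.2 hm, ?_⟩
  rw [← hlim, ← Filter.limsup_nat_add (fun n : ℕ => distNearInt (x * (q : ℝ) ^ n)) N]
  simp only [hval]
  rfl

/-! ### Realising a word as a limit of tails -/

theorem lex3le_of_prefix {x y m : W3} {L : ℕ} (hy : lex3le y m) (hxy : ∀ i < L, x i = y i)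
    (hne : ∃ i < L, y i ≠ m i) : lex3le x m := by
  obtain ⟨i, hi, hne⟩ := hne
  rcases hy with rfl | ⟨j, hj, hlt⟩
  · exact absurd rfl hne
  · have hji : j ≤ i := not_lt.1 fun h => hne (hj i h)
    refine Or.inr ⟨j, fun l hl => ?_, ?_⟩
    · rw [hxy l (by omega), hj l hl]
    · rwa [hxy j (by omega)]

theorem lex3le_of_shiftn {x y : W3} {L : ℕ} (hxy : ∀ i < L, x i = y i)
    (h : lex3le (shiftn x L) (shiftn y L)) : lex3le x y := by
  rw [lex3le_iff] at h ⊢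
  have h1 := pow_mul_piBeta3_sub one_lt_four_real hxy
  have h2 : 0 ≤ piBeta3 4 y - piBeta3 4 x :=
    nonneg_of_mul_nonneg_right (by linarith) (pow_pos (by norm_num : (0 : ℝ) < 4) L)
  linarith

/-- No nonempty suffix of the prefix of length `n` of `m` is the negative of a prefix of `m`. -/
def IsRestartable (m : W3) (n : ℕ) : Prop :=
  0 < n ∧ ∀ t < n, ¬ ∀ i, t + i < n → m (t + i) = (m i).negT

theorem IsAbsMax.neg_prefix_extends {m : W3} (h : IsAbsMax m) {t t' n : ℕ} (htt' : t < t')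
    (ht'n : t' ≤ n) (ht : ∀ i, t + i < n → m (t + i) = (m i).negT)
    (ht' : ∀ i, t' + i < n + 1 → m (t' + i) = (m i).negT) : m n = (m (n - t)).negT := by
  have h1 := toInt_le_of_lex3le (h.negW_shiftn_le t) (n := n - t) fun i hi => by
    simp only [negW, shiftn]
    rw [add_comm, ht i (by omega), T3.negT_negT]
  have h2 := toInt_le_of_lex3le (h.shiftn_le (t' - t)) (n := n - t') fun i hi => by
    have e1 := ht (i + (t' - t)) (by omega)
    have e2 := ht' i (by omega)
    rw [show t + (i + (t' - t)) = t' + i by omega] at e1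
    rw [shiftn, ← (m (i + (t' - t))).negT_negT, ← e1, e2, T3.negT_negT]
  simp only [negW, shiftn, T3.toInt_negT] at h1 h2
  rw [show n - t + t = n by omega] at h1
  rw [show n - t' + (t' - t) = n - t by omega] at h2
  have h3 := congrArg T3.toInt (ht' (n - t') (by omega))
  rw [show t' + (n - t') = n by omega, T3.toInt_negT] at h3
  apply T3.toInt_injective
  rw [T3.toInt_negT]
  omega

theorem IsAbsMax.antiperiodic_or_restartable {m : W3} (h : IsAbsMax m) :
    (∃ s, 0 < s ∧ ∀ i, m (s + i) = (m i).negT) ∨ ∀ N, ∃ n ≥ N, IsRestartable m n := by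
  by_contra! hcon
  obtain ⟨hper, N, hN⟩ := hcon
  have hbad : ∀ n, N + 1 ≤ n → ∃ t, t < n ∧ ∀ i, t + i < n → m (t + i) = (m i).negT := by
    intro n hn
    have := hN n (by omega)
    unfold IsRestartable at this
    push Not at this
    exact this (by omega)
  have hex := hbad (N + 1) le_rfl
  obtain ⟨htN, ht⟩ := Nat.find_spec hex
  have hmin : ∀ {t'}, t' < Nat.find hex → ¬(t' < N + 1 ∧ ∀ i, t' + i < N + 1 →
    m (t' + i) = (m i).negT) := Nat.find_min hex
  generalize Nat.find hex = t at htN ht hmin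
  have hall : ∀ k i, t + i < N + 1 + k → m (t + i) = (m i).negT := by
    intro k
    induction k with
    | zero => exact ht
    | succ k ih =>
      obtain ⟨t', ht'n, ht'⟩ := hbad (N + 1 + k + 1) (by omega)
      rcases lt_trichotomy t' t with hlt | rfl | hlt
      · exact absurd ⟨by omega, fun i hi => ht' i (by omega)⟩ (hmin hlt)
      · exact ht'
      · intro i hi
        rcases (show t + i < N + 1 + k ∨ t + i = N + 1 + k by omega) with hi | hi
        · exact ih i hi
        · have := h.neg_prefix_extends hlt (n := N + 1 + k) (by omega) ih ht'
          rw [hi, this]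
          congr 2
          omega
  have hanti : ∀ i, m (t + i) = (m i).negT := fun i => hall (t + i) i (by omega)
  rcases Nat.eq_zero_or_pos t with rfl | hpos
  · have hz : ∀ i, m i = T3.zer := fun i => by
      have := hanti i
      rw [zero_add] at this
      cases hi : m i <;> simp [hi, T3.negT] at this ⊢
    obtain ⟨i, hi⟩ := hper 1 one_pos
    exact hi (by rw [hz, hz]; rfl)
  · obtain ⟨i, hi⟩ := hper t hpos
    exact hi (hanti i)

/-- The factor of `m` between positions `t` and `n`, followed by `-m`. -/
def restart (m : W3) (t n : ℕ) : W3 :=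
  fun i => if t + i < n then m (t + i) else (m (t + i - n)).negT

theorem IsAbsMax.abs_restart_le {m : W3} (h : IsAbsMax m) {t n : ℕ} (hn : IsRestartable m n)
    (ht : t < n) : |piBeta3 4 (restart m t n)| ≤ piBeta3 4 m := by
  have hpre : ∀ i < n - t, restart m t n i = shiftn m t i := fun i hi => by
    rw [restart, if_pos (by omega), shiftn, add_comm]
  rw [abs_le', ← piBeta3_negW, ← lex3le_iff, ← lex3le_iff]
  constructor
  · by_cases hall : ∀ i < n - t, shiftn m t i = m i
    · refine lex3le_of_shiftn (L := n - t) (fun i hi => (hpre i hi).trans (hall i hi)) ?_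
      have he : shiftn (restart m t n) (n - t) = negW m := by
        funext i
        rw [shiftn, restart, if_neg (by omega), negW]
        congr 2
        omega
      rw [he, lex3le_iff, piBeta3_negW]
      exact (abs_le.1 (h (n - t))).1
    · push Not at hall
      exact lex3le_of_prefix (h.shiftn_le t) hpre hall
  · refine lex3le_of_prefix (L := n - t) (h.negW_shiftn_le t)
      (fun i hi => congrArg T3.negT (hpre i hi)) ?_
    have := hn.2 t ht
    push Not at this
    obtain ⟨i, hi, hne⟩ := this
    refine ⟨i, by omega, fun he => hne ?_⟩
    rw [← he, negW, T3.negT_negT, shiftn, add_comm]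

/-- Position `j` in a concatenation of blocks of lengths `n 0, n 1, …`: the index of the block
and the offset in the block. -/
def blockPos (n : ℕ → ℕ) : ℕ → ℕ × ℕ
  | 0 => (0, 0)
  | j + 1 => if (blockPos n j).2 + 1 < n (blockPos n j).1
      then ((blockPos n j).1, (blockPos n j).2 + 1) else ((blockPos n j).1 + 1, 0)

/-- The concatenation of the prefixes of `m` of lengths `n 0, n 1, …` with alternating signs. -/
def blockWord (n : ℕ → ℕ) (m : W3) : W3 :=
  fun j => if Even (blockPos n j).1 then m (blockPos n j).2 else (m (blockPos n j).2).negT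

theorem blockPos_snd_lt {n : ℕ → ℕ} (hn : ∀ k, 0 < n k) (j : ℕ) :
    (blockPos n j).2 < n (blockPos n j).1 := by
  cases j with
  | zero => exact hn 0
  | succ j =>
    rw [blockPos]
    split_ifs with h
    · exact h
    · exact hn _

theorem blockPos_add {n : ℕ → ℕ} {j k t : ℕ} (hj : blockPos n j = (k, t)) (i : ℕ)
    (h : t + i < n k) : blockPos n (j + i) = (k, t + i) := by
  induction i with
  | zero => exact hj
  | succ i ih =>
    rw [← add_assoc, blockPos, ih (by omega), if_pos (by omega)]
    rfl

theorem blockPos_next {n : ℕ → ℕ} {j k t : ℕ} (hj : blockPos n j = (k, t)) (ht : t < n k) :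
    blockPos n (j + (n k - t)) = (k + 1, 0) := by
  obtain ⟨d, hd⟩ : ∃ d, n k - t = d + 1 := ⟨n k - t - 1, by omega⟩
  rw [hd, ← add_assoc, blockPos, blockPos_add hj d (by omega), if_neg (by simp only; omega)]

theorem exists_blockPos_eq {n : ℕ → ℕ} (hn : ∀ k, 0 < n k) (k : ℕ) :
    ∃ j ≥ k, blockPos n j = (k, 0) := by
  induction k with
  | zero => exact ⟨0, le_rfl, rfl⟩
  | succ k ih =>
    obtain ⟨j, hj, hj'⟩ := ih
    have := hn k
    exact ⟨j + (n k - 0), by omega, blockPos_next hj' this⟩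

theorem monotone_blockPos_fst (n : ℕ → ℕ) : Monotone fun j => (blockPos n j).1 := by
  refine monotone_nat_of_le_succ fun j => ?_
  simp only [blockPos]
  split_ifs <;> simp

theorem blockWord_add {n : ℕ → ℕ} {m : W3} {j k t : ℕ} (hj : blockPos n j = (k, t))
    (ht : t < n k) {i : ℕ} (hi : i < n (k + 1)) :
    blockWord n m (i + j) =
      if Even k then restart m t (n k) i else negW (restart m t (n k)) i := by
  by_cases h : t + i < n k
  · rw [blockWord, add_comm i j, blockPos_add hj i h, negW, restart, if_pos h]
  · have hpos : blockPos n (i + j) = (k + 1, t + i - n k) := by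
      have := blockPos_add (blockPos_next hj ht) (t + i - n k) (by omega)
      rw [zero_add] at this
      rw [← this]
      congr 1
      omega
    rw [blockWord, hpos, negW, restart, if_neg h, T3.negT_negT]
    by_cases hk : Even k <;> simp [hk, Nat.even_add_one]

theorem IsAbsMax.exists_isTailLimit {m : W3} (h : IsAbsMax m) :
    ∃ a, IsTailLimit a m ∧ ∀ b, IsTailLimit a b → |piBeta3 4 b| ≤ piBeta3 4 m := by
  have hcl : IsClosed {u : W3 | |piBeta3 4 u| ≤ piBeta3 4 m} :=
    isClosed_le (continuous_piBeta3 one_lt_four_real).abs continuous_const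
  rcases h.antiperiodic_or_restartable with ⟨s, hs, hanti⟩ | hres
  · refine ⟨m, fun N => ?_, fun b hb => hcl.mem_of_forall_prefix (b := b) fun N => ?_⟩
    · have hper : ∀ k i, m (i + 2 * s * k) = m i := by
        intro k
        induction k with
        | zero => simp
        | succ k ih =>
          intro i
          rw [show i + 2 * s * (k + 1) = s + (s + (i + 2 * s * k)) by ring, hanti, hanti,
            T3.negT_negT, ih]
      rw [Filter.frequently_atTop]
      refine fun k => ⟨2 * s * k, ?_, fun i _ => hper k i⟩
      exact Nat.le_mul_of_pos_left k (by omega)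
    · obtain ⟨j, hj⟩ := (hb N).exists
      exact ⟨shiftn m j, h j, hj⟩
  · choose n hn hres using fun k => hres k
    have hpos : ∀ k, 0 < n k := fun k => (hres k).1
    refine ⟨blockWord n m, fun N => ?_, fun b hb => hcl.mem_of_forall_prefix (b := b) fun N => ?_⟩
    · rw [Filter.frequently_atTop]
      intro k
      obtain ⟨j, hj, hj'⟩ := exists_blockPos_eq hpos (2 * (k + N))
      refine ⟨j, by omega, fun i hi => ?_⟩
      have := hn (2 * (k + N))
      have := blockPos_add hj' i (by omega)
      rw [zero_add] at this
      rw [blockWord, add_comm, this, if_pos (even_two_mul _)]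
    · obtain ⟨j₀, -, hj₀⟩ := exists_blockPos_eq hpos N
      obtain ⟨j, hjb, hj⟩ := ((hb N).and_eventually (Filter.eventually_ge_atTop j₀)).exists
      have hk := monotone_blockPos_fst n hj
      have ht := blockPos_snd_lt hpos j
      obtain ⟨k, t, hkt⟩ : ∃ k t, blockPos n j = (k, t) := ⟨_, _, rfl⟩
      simp only [hj₀, hkt] at hk ht
      have hle := h.abs_restart_le (hres k) ht
      have hlen := hn (k + 1)
      have hagree : ∀ i < N, _ := fun i hi =>
        (blockWord_add (m := m) hkt ht (i := i) (by omega)).symm.trans (hjb i hi)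
      by_cases hev : Even k
      · simp only [hev, if_true] at hagree
        exact ⟨_, hle, hagree⟩
      · simp only [hev, if_false] at hagree
        refine ⟨_, ?_, hagree⟩
        rw [Set.mem_ofPred_eq, piBeta3_negW, abs_neg]
        exact hle

/-! ### Base two -/

theorem one_lt_two_real : (1 : ℝ) < 2 := by norm_num

theorem abs_piBeta3_two_le (a : W3) : |piBeta3 2 a| ≤ 1 :=
  (abs_piBeta3_le one_lt_two_real a).trans_eq (by norm_num)

/-- Consecutive nonzero letters of `b` are distinct. -/
def IsAlternating (b : W3) : Prop :=
  ∀ j k, j < k → (∀ i, j < i → i < k → b i = T3.zer) → b j ≠ T3.zer → b k ≠ b j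

theorem IsAlternating.shiftn {b : W3} (h : IsAlternating b) (n : ℕ) :
    IsAlternating (shiftn b n) := by
  intro j k hjk hz hne
  refine h (j + n) (k + n) (by omega) (fun i hi hi' => ?_) hne
  have := hz (i - n) (by omega) (by omega)
  rwa [_root_.shiftn, Nat.sub_add_cancel (by omega)] at this

theorem IsAlternating.negW {b : W3} (h : IsAlternating b) : IsAlternating (negW b) := by
  have hz : ∀ x : T3, x.negT = T3.zer ↔ x = T3.zer := fun x => by cases x <;> simp [T3.negT]
  intro j k hjk hzero hne he
  refine h j k hjk (fun i hi hi' => (hz _).1 (hzero i hi hi')) (fun h0 => hne ((hz _).2 h0)) ?_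
  rw [← (b k).negT_negT, ← (b j).negT_negT]
  exact congrArg T3.negT he

/-- The first nonzero letter of `b`, if there is one, is positive. -/
def StartsPos (b : W3) : Prop := ∀ i, (∀ l < i, b l = T3.zer) → b i ≠ T3.neg

theorem startsPos_or (b : W3) : StartsPos b ∨ StartsPos (negW b) := by
  by_contra! h
  unfold StartsPos at h
  push Not at h
  obtain ⟨⟨i, hi, hi'⟩, j, hj, hj'⟩ := h
  have hj : ∀ l < j, b l = T3.zer := fun l hl => by
    have := hj l hl
    cases hb : b l <;> simp [negW, hb, T3.negT] at this ⊢
  have hj' : b j = T3.pos := by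
    cases hb : b j <;> simp [negW, hb, T3.negT] at hj' ⊢
  rcases lt_trichotomy i j with hij | rfl | hij
  · simp [hj i hij] at hi'
  · simp [hj'] at hi'
  · simp [hi j hij] at hj'

theorem IsAlternating.piBeta3_two_bounds (n : ℕ) : ∀ b : W3, IsAlternating b → StartsPos b →
    -(2⁻¹ : ℝ) ^ n ≤ piBeta3 2 b ∧ piBeta3 2 b ≤ 1 / 2 + 2⁻¹ ^ n := by
  induction n with
  | zero =>
    intro b _ _
    have := abs_le.1 (abs_piBeta3_two_le b)
    norm_num
    constructor <;> linarith
  | succ n ih =>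
    intro b hb hs
    have hrec := piBeta3_eq one_lt_two_real b
    have hp : (0 : ℝ) < 2⁻¹ ^ n := by positivity
    rw [pow_succ]
    cases h0 : b 0 with
    | neg => exact absurd h0 (hs 0 fun l hl => absurd hl l.not_lt_zero)
    | zer =>
      have hs' : StartsPos (_root_.shiftn b 1) := fun i hi => by
        refine hs (i + 1) fun l hl => ?_
        cases l with
        | zero => exact h0
        | succ l => exact hi l (by omega)
      obtain ⟨h1, h2⟩ := ih _ (hb.shiftn 1) hs'
      rw [h0] at hrec
      norm_num [T3.toInt] at hrec
      constructor <;> linarith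
    | pos =>
      have hs' : StartsPos (_root_.negW (_root_.shiftn b 1)) := fun i hi he => by
        refine hb 0 (i + 1) (by omega) (fun l hl hl' => ?_) (by simp [h0]) ?_
        · have := hi (l - 1) (by omega)
          rw [_root_.negW, _root_.shiftn, Nat.sub_add_cancel (by omega)] at this
          cases hbl : b l <;> simp [hbl, T3.negT] at this ⊢
        · rw [_root_.negW, _root_.shiftn] at he
          rw [h0]
          cases hbl : b (i + 1) <;> simp [hbl, T3.negT] at he ⊢
      obtain ⟨h1, h2⟩ := ih _ (hb.shiftn 1).negW hs'
      rw [piBeta3_negW] at h1 h2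
      rw [h0] at hrec
      norm_num [T3.toInt] at hrec
      constructor <;> linarith

theorem IsAlternating.abs_piBeta3_two_le_half {b : W3} (hb : IsAlternating b) :
    |piBeta3 2 b| ≤ 1 / 2 := by
  have key : ∀ c : W3, IsAlternating c → StartsPos c → |piBeta3 2 c| ≤ 1 / 2 := by
    intro c hc hs
    have ht : Filter.Tendsto (fun n : ℕ => (2⁻¹ : ℝ) ^ n) Filter.atTop (nhds 0) :=
      tendsto_pow_atTop_nhds_zero_of_lt_one (by norm_num) (by norm_num)
    have h1 := le_of_tendsto' ht.neg fun n => (piBeta3_two_bounds n c hc hs).1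
    have h2 := ge_of_tendsto' (ht.const_add (1 / 2)) fun n => (piBeta3_two_bounds n c hc hs).2
    rw [abs_le]
    constructor <;> linarith
  rcases startsPos_or b with h | h
  · exact key b hb h
  · rw [← abs_neg, ← piBeta3_negW]
    exact key _ hb.negW h

theorem neg_one_lt_piBeta3_two {i : ℕ} : ∀ {b : W3}, b i ≠ T3.neg → -1 < piBeta3 2 b := by
  induction i with
  | zero =>
    intro b hb
    have hrec := piBeta3_eq one_lt_two_real b
    have := abs_le.1 (abs_piBeta3_two_le (shiftn b 1))
    have h0 : (0 : ℝ) ≤ (b 0).toInt := by cases h : b 0 <;> simp_all [T3.toInt]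
    linarith
  | succ i ih =>
    intro b hb
    have hrec := piBeta3_eq one_lt_two_real b
    have := ih (b := shiftn b 1) hb
    have h0 : (-1 : ℝ) ≤ (b 0).toInt := by exact_mod_cast (b 0).neg_one_le_toInt
    linarith

theorem IsAbsMax.exists_ne_neg {m : W3} (h : IsAbsMax m) (k : ℕ) :
    ∃ i, shiftn m k i ≠ T3.neg := by
  by_contra! hneg
  have he : shiftn m k = negW oneW3 := funext hneg
  have h1 : piBeta3 4 (shiftn m k) = -(1 / 3) := by
    rw [he, piBeta3_negW, piBeta3_oneW3 one_lt_four_real]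
    norm_num
  have h2 : ∀ j, 1 / 3 ≤ piBeta3 4 (shiftn m j) := by
    intro j
    induction j with
    | zero =>
      have := h k
      rw [h1, abs_neg, abs_of_nonneg (by norm_num)] at this
      exact this
    | succ j ih =>
      have hrec := piBeta3_shiftn one_lt_four_real m j
      have : ((m j).toInt : ℝ) ≤ 1 := by exact_mod_cast (m j).toInt_le_one
      linarith
  have := h2 k
  rw [h1] at this
  norm_num at this

theorem IsAbsMax.half_lt_piBeta3_two {m : W3} (h : IsAbsMax m) {l : ℕ} (h0 : m 0 = T3.pos)
    (hz : ∀ i, 0 < i → i < l + 1 → m i = T3.zer) (hl : m (l + 1) = T3.pos) :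
    1 / 2 < piBeta3 2 m := by
  have h1 := piBeta3_eq one_lt_two_real m
  have h2 := piBeta3_shiftn one_lt_two_real m (l + 1)
  obtain ⟨i, hi⟩ := h.exists_ne_neg (l + 1 + 1)
  have h3 := neg_one_lt_piBeta3_two hi
  have h4 := pow_mul_piBeta3_sub one_lt_two_real (a := zeroW3) (b := shiftn m 1) (n := l)
    fun i hi => (hz (i + 1) (by omega) (by omega)).symm
  rw [shiftn_shiftn, show shiftn zeroW3 l = zeroW3 from rfl, piBeta3_zeroW3, sub_zero, sub_zero,
    add_comm 1 l] at h4
  rw [h0] at h1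
  rw [hl] at h2
  norm_num [T3.toInt] at h1 h2
  have h5 : 0 < (2 : ℝ) ^ l * piBeta3 2 (shiftn m 1) := by linarith
  have h6 := pos_of_mul_pos_right h5 (by positivity)
  linarith

theorem IsAbsMax.isAlternating_of_le {m : W3} (h : IsAbsMax m) (hm : piBeta3 2 m ≤ 1 / 2)
    {b : W3} (hb : ∀ k, |piBeta3 4 (shiftn b k)| ≤ piBeta3 4 m) : IsAlternating b := by
  have key : ∀ c : W3, (∀ k, |piBeta3 4 (shiftn c k)| ≤ piBeta3 4 m) → ∀ j k, j < k →
      (∀ i, j < i → i < k → c i = T3.zer) → c j = T3.pos → c k = T3.pos → False := by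
    intro c hc j k hjk hz hj hk
    have hle : lex3le (shiftn c j) m := lex3le_iff.2 ((le_abs_self _).trans (hc j))
    obtain ⟨d, rfl⟩ : ∃ d, k = d + 1 + j := ⟨k - j - 1, by omega⟩
    have hpos : ∀ x : T3, T3.pos.toInt ≤ x.toInt → x = T3.pos := fun x => by
      cases x <;> simp [T3.toInt]
    have h0 : m 0 = T3.pos := by
      have := toInt_le_of_lex3le hle (n := 0) (by simp)
      rw [shiftn, zero_add, hj] at this
      exact hpos _ this
    have hc0 : ∀ i, 0 < i → i < d + 1 → shiftn c j i = T3.zer := fun i hi hi' =>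
      hz _ (by omega) (by omega)
    by_cases hex : ∃ i, 0 < i ∧ i < d + 1 ∧ m i ≠ T3.zer
    · obtain ⟨hi0, hid, hne⟩ := Nat.find_spec hex
      have hmin : ∀ {i}, i < Nat.find hex → ¬(0 < i ∧ i < d + 1 ∧ m i ≠ T3.zer) :=
        Nat.find_min hex
      generalize Nat.find hex = i at hi0 hid hne hmin
      have hzero : ∀ l, 0 < l → l < i → m l = T3.zer := fun l hl hl' => by
        by_contra hh
        exact hmin hl' ⟨hl, by omega, hh⟩
      have := toInt_le_of_lex3le hle (n := i) fun l hl => by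
        rcases Nat.eq_zero_or_pos l with rfl | hl0
        · rw [shiftn, zero_add, hj, h0]
        · rw [hc0 l hl0 (by omega), hzero l hl0 hl]
      rw [hc0 i hi0 hid] at this
      obtain ⟨l, rfl⟩ : ∃ l, i = l + 1 := ⟨i - 1, by omega⟩
      have hl : m (l + 1) = T3.pos := by
        cases hml : m (l + 1) <;> simp [hml, T3.toInt] at this hne ⊢
      exact absurd (h.half_lt_piBeta3_two h0 hzero hl) hm.not_gt
    · push Not at hex
      have := toInt_le_of_lex3le hle (n := d + 1) fun l hl => by
        rcases Nat.eq_zero_or_pos l with rfl | hl0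
        · rw [shiftn, zero_add, hj, h0]
        · rw [hc0 l hl0 hl, hex l hl0 hl]
      rw [shiftn, hk] at this
      exact absurd (h.half_lt_piBeta3_two h0 hex (hpos _ this)) hm.not_gt
  intro j k hjk hz hne he
  cases hbj : b j with
  | zer => exact hne hbj
  | pos => exact key b hb j k hjk hz hbj (he.trans hbj)
  | neg =>
    refine key (negW b) (fun k => ?_) j k hjk (fun i hi hi' => ?_) ?_ ?_
    · rw [← negW_shiftn, piBeta3_negW, abs_neg]
      exact hb k
    · simp [negW, hz i hi hi', T3.negT]
    · simp [negW, hbj, T3.negT]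
    · simp [negW, he, hbj, T3.negT]

/-! ### The multiplicative Lagrange spectrum -/

theorem IsAbsMax.piBeta3_mem_Ltilde {q : ℕ} (hq : 2 ≤ q) {m : W3} (h : IsAbsMax m)
    (hm : piBeta3 q m ≤ 1 / 2) : piBeta3 q m ∈ Ltilde q := by
  have hq1 : (1 : ℝ) < q := by exact_mod_cast hq
  obtain ⟨a, hlim, hle⟩ := h.exists_isTailLimit
  refine piBeta3_mem_Ltilde_of_isTailLimit hq1 h (fun b hb k => ?_) hlim hle
  rcases hq.eq_or_lt with rfl | hq3
  · exact ((h.isAlternating_of_le (by exact_mod_cast hm) hb).shiftn k).abs_piBeta3_two_le_half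
  · refine (abs_piBeta3_le hq1 _).trans ?_
    have : (3 : ℝ) ≤ q := by exact_mod_cast hq3
    exact one_div_le_one_div_of_le (by norm_num) (by linarith)

theorem abs_digit_le_one {q : ℕ} {x : ℝ} {n : ℕ}
    (h : |(q : ℝ) * (x * (q : ℝ) ^ n - round (x * (q : ℝ) ^ n)) -
      (x * (q : ℝ) ^ (n + 1) - round (x * (q : ℝ) ^ (n + 1)))| < 2) :
    |round (x * (q : ℝ) ^ (n + 1)) - q * round (x * (q : ℝ) ^ n)| ≤ 1 := by
  have he : (q : ℝ) * (x * (q : ℝ) ^ n - round (x * (q : ℝ) ^ n)) -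
      (x * (q : ℝ) ^ (n + 1) - round (x * (q : ℝ) ^ (n + 1))) =
      ((round (x * (q : ℝ) ^ (n + 1)) - q * round (x * (q : ℝ) ^ n) : ℤ) : ℝ) := by
    push_cast
    ring
  rw [he] at h
  have h' : |round (x * (q : ℝ) ^ (n + 1)) - q * round (x * (q : ℝ) ^ n)| < 2 := by
    exact_mod_cast h
  omega

theorem Ltilde_subset_of_le_three {q : ℕ} (hq : 2 ≤ q) (hq3 : q ≤ 3) :
    Ltilde q ⊆ piBeta3 q '' MAbs lex3le := by
  rintro r ⟨x, rfl⟩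
  have hq2 : (2 : ℝ) ≤ q := by exact_mod_cast hq
  have hq3 : (q : ℝ) ≤ 3 := by exact_mod_cast hq3
  have hround : ∀ y : ℝ, -(1 / 2) ≤ y - round y ∧ y - round y < 1 / 2 := fun y => by
    rw [round_eq]
    have h1 := Int.floor_le (y + 1 / 2)
    have h2 := Int.lt_floor_add_one (y + 1 / 2)
    constructor <;> linarith
  refine limsup_mem_image_of_digits (by linarith) (Filter.Eventually.of_forall fun n => ?_)
  apply abs_digit_le_one
  obtain ⟨h1, h2⟩ := hround (x * (q : ℝ) ^ n)
  obtain ⟨h3, h4⟩ := hround (x * (q : ℝ) ^ (n + 1))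
  rw [abs_lt]
  constructor <;> nlinarith

theorem Ltilde_inter_subset {q : ℕ} (hq : 4 ≤ q) :
    Ltilde q ∩ Set.Icc 0 (1 / ((q : ℝ) - 1)) ⊆ piBeta3 q '' MAbs lex3le := by
  rintro r ⟨⟨x, rfl⟩, -, hle⟩
  have hq4 : (4 : ℝ) ≤ q := by exact_mod_cast hq
  refine limsup_mem_image_of_digits (by linarith) ?_
  have hlt : 1 / ((q : ℝ) - 1) < 2 / (q + 1) := by
    rw [div_lt_div_iff₀ (by linarith) (by linarith)]
    linarith
  have hev : ∀ᶠ n : ℕ in Filter.atTop, distNearInt (x * (q : ℝ) ^ n) < 2 / (q + 1) :=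
    Filter.eventually_lt_of_limsup_lt (hle.trans_lt hlt)
      (Filter.isBoundedUnder_of ⟨1 / 2, fun n => distNearInt_le_half _⟩)
  filter_upwards [hev, (Filter.tendsto_add_atTop_nat 1).eventually hev] with n h1 h2
  apply abs_digit_le_one
  rw [lt_div_iff₀ (by linarith)] at h1 h2
  refine (abs_sub _ _).trans_lt ?_
  rw [abs_mul, abs_of_pos (by linarith : (0 : ℝ) < q)]
  change distNearInt _ * _ < 2 at h1 h2
  change (q : ℝ) * distNearInt _ + distNearInt _ < 2
  nlinarith

theorem two_div_mem_Ltilde {q : ℕ} (hq : 3 ≤ q) : 2 / ((q : ℝ) + 1) ∈ Ltilde q := by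
  have hq3 : (3 : ℝ) ≤ q := by exact_mod_cast hq
  set x : ℝ := 2 / ((q : ℝ) + 1) with hx
  have hx0 : 0 ≤ x := by positivity
  have hx1 : x ≤ 1 / 2 := by
    rw [hx, div_le_div_iff₀ (by linarith) (by norm_num)]
    linarith
  have hqx : x * q = 2 - x := by
    rw [hx]
    field_simp
    ring
  have key : ∀ n : ℕ, ∃ z : ℤ, x * (q : ℝ) ^ n = z + x ∨ x * (q : ℝ) ^ n = z + -x := by
    intro n
    induction n with
    | zero => exact ⟨0, by simp⟩
    | succ n ih =>
      obtain ⟨z, hz | hz⟩ := ih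
      · refine ⟨z * q + 2, Or.inr ?_⟩
        rw [pow_succ, ← mul_assoc, hz, add_mul, hqx]
        push_cast
        ring
      · refine ⟨z * q - 2, Or.inl ?_⟩
        rw [pow_succ, ← mul_assoc, hz, add_mul, neg_mul, hqx]
        push_cast
        ring
  have hval : ∀ n : ℕ, distNearInt (x * (q : ℝ) ^ n) = x := by
    intro n
    obtain ⟨z, hz | hz⟩ := key n
    · rw [hz, distNearInt_intCast_add, distNearInt_of_abs_le, abs_of_nonneg hx0]
      rwa [abs_of_nonneg hx0]
    · rw [hz, distNearInt_intCast_add, distNearInt_of_abs_le, abs_neg, abs_of_nonneg hx0]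
      rwa [abs_neg, abs_of_nonneg hx0]
  refine ⟨x, ?_⟩
  simp only [hval]
  exact Filter.limsup_const x

theorem Ltilde_subset_Icc (q : ℝ) : Ltilde q ⊆ Set.Icc 0 (1 / 2) := by
  rintro r ⟨x, rfl⟩
  exact limsup_distNearInt_mem_Icc _

theorem image_MAbs_subset {q : ℕ} (hq : 3 ≤ q) : piBeta3 q '' MAbs lex3le ⊆ Ltilde q := by
  rintro r ⟨m, hm, rfl⟩
  have hq3 : (3 : ℝ) ≤ q := by exact_mod_cast hq
  refine (mem_MAbs_iff.1 hm).piBeta3_mem_Ltilde (by omega) ((le_abs_self _).trans ?_)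
  refine (abs_piBeta3_le (by linarith) m).trans ?_
  exact one_div_le_one_div_of_le (by norm_num) (by linarith)

theorem Ltilde_two : Ltilde 2 = (piBeta3 2 '' MAbs lex3le) ∩ Set.Icc 0 (1 / 2) := by
  apply Set.Subset.antisymm
  · refine Set.subset_inter ?_ (Ltilde_subset_Icc 2)
    exact_mod_cast Ltilde_subset_of_le_three (q := 2) le_rfl (by norm_num)
  · rintro r ⟨⟨m, hm, rfl⟩, -, hr⟩
    exact_mod_cast (mem_MAbs_iff.1 hm).piBeta3_mem_Ltilde (q := 2) le_rfl (by exact_mod_cast hr)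

/-- With `≤_lex` the lexicographic order on `{0,±1}^∞` induced by
`-1 < 0 < 1`: (i) `L̃_2 = π_2(M^abs_lex) ∩ [0,1/2]` and `L̃_2 ≠ π_2(M^abs_lex)`;
(ii) `L̃_3 = π_3(M^abs_lex)`; (iii) for every integer `q ≥ 4`,
`π_q(M^abs_lex) = L̃_q ∩ [0, 1/(q-1)]` and `π_q(M^abs_lex) ≠ L̃_q`. -/
theorem stmt_18 :
    (Ltilde 2 = (piBeta3 2 '' MAbs lex3le) ∩ Set.Icc 0 (1 / 2) ∧
      Ltilde 2 ≠ piBeta3 2 '' MAbs lex3le) ∧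
    (Ltilde 3 = piBeta3 3 '' MAbs lex3le) ∧
    (∀ q : ℕ, 4 ≤ q →
      piBeta3 q '' MAbs lex3le = Ltilde q ∩ Set.Icc 0 (1 / ((q : ℝ) - 1)) ∧
      piBeta3 q '' MAbs lex3le ≠ Ltilde q) := by
  refine ⟨⟨Ltilde_two, fun h => ?_⟩, ?_, fun q hq => ⟨?_, fun h => ?_⟩⟩
  · have h1 : piBeta3 2 oneW3 ∈ Ltilde 2 := h ▸ ⟨oneW3, mem_MAbs_iff.2 isAbsMax_oneW3, rfl⟩
    have h2 := (Ltilde_subset_Icc 2 h1).2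
    rw [piBeta3_oneW3 one_lt_two_real] at h2
    norm_num at h2
  · apply Set.Subset.antisymm
    · exact_mod_cast Ltilde_subset_of_le_three (q := 3) (by norm_num) le_rfl
    · exact_mod_cast image_MAbs_subset (q := 3) le_rfl
  · have hq1 : (1 : ℝ) < q := by exact_mod_cast (by omega : 1 < q)
    refine Set.Subset.antisymm (Set.subset_inter (image_MAbs_subset (by omega)) ?_)
      (Ltilde_inter_subset hq)
    intro r hr
    refine ⟨(Ltilde_subset_Icc q (image_MAbs_subset (by omega) hr)).1, ?_⟩
    obtain ⟨m, -, rfl⟩ := hr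
    exact (le_abs_self _).trans (abs_piBeta3_le hq1 m)
  · have hq4 : (4 : ℝ) ≤ q := by exact_mod_cast hq
    have hmem := two_div_mem_Ltilde (q := q) (by omega)
    rw [← h] at hmem
    obtain ⟨m, -, hm⟩ := hmem
    have hle := (le_abs_self _).trans (abs_piBeta3_le (by linarith : (1 : ℝ) < q) m)
    rw [hm, div_le_div_iff₀ (by linarith) (by linarith)] at hle
    linarith
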